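/- arXiv:1501.04036 — 4 statements merged into one kernel-verified Lean document; each statement's English description precedes it below -/
import Mathlib

section
/- Let q be a prime power, r > 1 an integer with q ≡ 1 (mod r), and let b, c ∈ F_q with b^r - c ≠ 0. Let θ be an element of the degree-r extension F_{q^r} with θ^r = b^r - c, and suppose ω = θ^(q-1) is a primitive r-th root of unity. Then the norm of b - θ from F_{q^r} to F_q satisfies (b - θ)^(1 + q + q^2 + ... + q^(r-1)) = c, where c is identified with its image in F_{q^r}. -/
open Finset in
/-- The factorization of `x ^ n - y ^ n` indexed by the powers of a primitive root of unity. -/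
theorem IsPrimitiveRoot.prod_range_sub_pow_mul {K : Type*} [Field K] {ζ : K} {n : ℕ}
    (hn : 0 < n) (h : IsPrimitiveRoot ζ n) (x y : K) :
    ∏ i ∈ range n, (x - ζ ^ i * y) = x ^ n - y ^ n := by
  rw [h.pow_sub_pow_eq_prod_sub_mul x y hn]
  refine prod_bij (fun i _ => ζ ^ i) ?_ ?_ ?_ fun _ _ => rfl
  · intro i _
    rw [Polynomial.mem_nthRootsFinset hn, pow_right_comm, h.pow_eq_one, one_pow]
  · intro i hi j hj hij
    exact h.pow_inj (mem_range.mp hi) (mem_range.mp hj) hij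
  · intro z hz
    have : NeZero n := ⟨hn.ne'⟩
    obtain ⟨i, hi, rfl⟩ := h.eq_pow_of_pow_eq_one ((Polynomial.mem_nthRootsFinset hn _).mp hz)
    exact ⟨i, mem_range.mpr hi, rfl⟩

/-- The iterated `q`-Frobenius of `b - θ` when `θ ^ q = ω * θ` and `ω ^ q = ω`. -/
theorem FiniteField.algebraMap_sub_pow_card_pow {F K : Type*} [Field F] [Field K] [Fintype F]
    [Algebra F K] (b : F) {θ ω : K} (hθ : θ ^ Fintype.card F = ω * θ)
    (hω : ω ^ Fintype.card F = ω) (i : ℕ) :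
    (algebraMap F K b - θ) ^ Fintype.card F ^ i = algebraMap F K b - ω ^ i * θ := by
  induction i with
  | zero => simp
  | succ i ih =>
    have hfrob := map_sub (FiniteField.frobeniusAlgHom F K) (algebraMap F K b) (ω ^ i * θ)
    simp only [AlgHom.commutes, FiniteField.coe_frobeniusAlgHom] at hfrob
    rw [pow_succ, pow_mul, ih, hfrob, mul_pow, pow_right_comm, hω, hθ, pow_succ, mul_assoc]

/-- The norm identity `(b - θ)^(1+q+⋯+q^(r-1)) = c` when `θ^r = b^r - c`
and `ω = θ^(q-1)` is a primitive `r`-th root of unity. -/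
theorem cipolla_lehmer_norm_eq
    (F K : Type*) [Field F] [Field K] [Fintype F] [Fintype K] [Algebra F K]
    (q r : ℕ) (hq : q = Fintype.card F) (hK : Fintype.card K = q ^ r)
    (hr : 1 < r) (hqr : q ≡ 1 [MOD r])
    (b c : F) (hbc : b ^ r - c ≠ 0)
    (θ : K) (hθ : θ ^ r = algebraMap F K (b ^ r - c))
    (hω : IsPrimitiveRoot (θ ^ (q - 1)) r) :
    (algebraMap F K b - θ) ^ (∑ i ∈ Finset.range r, q ^ i) = algebraMap F K c := by
  have hq0 : 0 < q := hq ▸ Fintype.card_pos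
  have hfrobω : (θ ^ (q - 1)) ^ q = θ ^ (q - 1) := by
    rw [pow_eq_pow_of_modEq hqr hω.pow_eq_one, pow_one]
  have hfrobθ : θ ^ q = θ ^ (q - 1) * θ := by rw [← pow_succ, Nat.sub_add_cancel hq0]
  subst hq
  rw [← Finset.prod_pow_eq_pow_sum]
  simp_rw [FiniteField.algebraMap_sub_pow_card_pow b hfrobθ hfrobω]
  rw [hω.prod_range_sub_pow_mul (by lia), hθ, ← map_pow, ← map_sub, sub_sub_cancel]
end

section
/- (H. C. Williams) Let q be a prime power and r an odd prime with q ≡ 1 (mod r). Let c ≠ 0 be an r-th power residue in F_q, and let b ∈ F_q be such that b^r - c is not an r-th power residue in F_q. Let θ ∈ F_{q^r} satisfy θ^r = b^r - c, and set α = b - θ. Then r divides N = 1 + q + q^2 + ... + q^(r-1), the element α^(N/r) lies in (the image of) F_q, and (α^(N/r))^r = c. -/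
open Polynomial in
/-- Elements of an extension of a finite field `F` fixed by the Frobenius of `F` lie in `F`. -/
lemma FiniteField.mem_range_algebraMap_of_pow_card_eq {F K : Type*} [Field F] [Fintype F]
    [Field K] [Algebra F K] {x : K} (hx : x ^ Fintype.card F = x) :
    x ∈ Set.range (algebraMap F K) := by
  have hsplits : (X ^ Fintype.card F - X : F[X]).Splits := by
    rw [splits_iff_card_roots, FiniteField.roots_X_pow_card_sub_X,
      FiniteField.X_pow_card_sub_X_natDegree_eq F Fintype.one_lt_card]
    rfl
  refine hsplits.mem_range_of_isRoot
    (FiniteField.X_pow_card_sub_X_ne_zero F Fintype.one_lt_card) ?_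
  simp [hx]

/-- `x ^ n - y ^ n` factors as the product of `x - ζ ^ i * y` for `i < n`. -/
lemma IsPrimitiveRoot.pow_sub_pow_eq_prod_range {R : Type*} [CommRing R] [IsDomain R] {ζ : R}
    {n : ℕ} (hζ : IsPrimitiveRoot ζ n) (hn : 0 < n) (x y : R) :
    x ^ n - y ^ n = ∏ i ∈ Finset.range n, (x - ζ ^ i * y) := by
  have : NeZero n := ⟨hn.ne'⟩
  rw [hζ.pow_sub_pow_eq_prod_sub_mul x y hn]
  symm
  refine Finset.prod_bij (fun i _ => ζ ^ i) ?_ ?_ ?_ (fun _ _ => rfl)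
  · intro i _
    rw [Polynomial.mem_nthRootsFinset hn, pow_right_comm, hζ.pow_eq_one, one_pow]
  · intro i hi j hj h
    exact hζ.pow_inj (Finset.mem_range.1 hi) (Finset.mem_range.1 hj) h
  · intro ξ hξ
    obtain ⟨i, hi, rfl⟩ := hζ.eq_pow_of_pow_eq_one ((Polynomial.mem_nthRootsFinset hn _).1 hξ)
    exact ⟨i, Finset.mem_range.2 hi, rfl⟩

/-- H. C. Williams: for `r` an odd prime, `c ≠ 0` an `r`-th power residue and
`b^r - c` not an `r`-th power residue, with `θ^r = b^r - c` and `α = b - θ`,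
`r` divides `N = 1 + q + ⋯ + q^(r-1)`, and `α^(N/r)` lies in `F_q` with `(α^(N/r))^r = c`. -/
theorem williams_rth_root
    (F K : Type*) [Field F] [Field K] [Fintype F] [Fintype K] [Algebra F K]
    (q r : ℕ) (hq : q = Fintype.card F) (hK : Fintype.card K = q ^ r)
    (hrp : r.Prime) (hrodd : Odd r) (hqr : q ≡ 1 [MOD r])
    (c : F) (hc0 : c ≠ 0) (hc : ∃ x : F, x ^ r = c)
    (b : F) (hb : ¬ ∃ x : F, x ^ r = b ^ r - c)
    (θ : K) (hθ : θ ^ r = algebraMap F K (b ^ r - c))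
    (N : ℕ) (hN : N = ∑ i ∈ Finset.range r, q ^ i) :
    r ∣ N ∧
    (algebraMap F K b - θ) ^ (N / r) ∈ Set.range (algebraMap F K) ∧
    ((algebraMap F K b - θ) ^ (N / r)) ^ r = algebraMap F K c := by
  have hr0 : r ≠ 0 := hrp.ne_zero
  have hq1 : 1 < q := hq ▸ Fintype.one_lt_card
  have hdvdN : r ∣ N := by
    rw [hN, ← Nat.modEq_zero_iff_dvd]
    have hsum : ∑ i ∈ Finset.range r, q ^ i ≡ ∑ i ∈ Finset.range r, 1 [MOD r] :=
      Nat.ModEq.sum fun i _ => by simpa using hqr.pow i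
    refine hsum.trans ?_
    simp [Nat.ModEq]
  have hdvdq : r ∣ q - 1 := (Nat.modEq_iff_dvd' hq1.le).1 hqr.symm
  have hsucc : q - 1 + 1 = q := by omega
  set a := b ^ r - c with ha
  have ha0 : a ≠ 0 := fun h => hb ⟨0, by rw [h, zero_pow hr0]⟩
  have hθ0 : θ ≠ 0 := by
    rintro rfl
    rw [zero_pow hr0, eq_comm, map_eq_zero] at hθ
    exact ha0 hθ
  -- `ω` is the ratio of `θ` and its conjugate, a primitive `r`-th root of unity in `F`.
  set ω : F := a ^ ((q - 1) / r) with hω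
  have hθω : θ ^ (q - 1) = algebraMap F K ω := by
    rw [hω, map_pow, ← hθ, ← pow_mul, Nat.mul_div_cancel' hdvdq]
  have hθq : θ ^ q = algebraMap F K ω * θ := by
    rw [← hθω, ← pow_succ, hsucc]
  have hωr : ω ^ r = 1 := by
    rw [hω, ← pow_mul, Nat.div_mul_cancel hdvdq, hq, FiniteField.pow_card_sub_one_eq_one a ha0]
  have hω1 : ω ≠ 1 := by
    intro h
    rw [h, map_one, one_mul, hq] at hθq
    obtain ⟨t, rfl⟩ := FiniteField.mem_range_algebraMap_of_pow_card_eq hθq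
    exact hb ⟨t, (algebraMap F K).injective (by rw [map_pow, hθ])⟩
  have hprim : IsPrimitiveRoot (algebraMap F K ω) r := by
    have : Fact r.Prime := ⟨hrp⟩
    exact (IsPrimitiveRoot.iff_orderOf.2 (orderOf_eq_prime hωr hω1)).map_of_injective
      (algebraMap F K).injective
  have hconj (i : ℕ) :
      (algebraMap F K b - θ) ^ q ^ i = algebraMap F K b - algebraMap F K ω ^ i * θ := by
    induction i with
    | zero => simp
    | succ i ih =>
      have hfrob : (algebraMap F K b - algebraMap F K (ω ^ i) * θ) ^ q =
          algebraMap F K b - algebraMap F K (ω ^ i) * θ ^ q := by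
        subst hq
        have := map_sub (FiniteField.frobeniusAlgHom F K) (algebraMap F K b)
          (algebraMap F K (ω ^ i) * θ)
        rwa [map_mul, AlgHom.commutes, AlgHom.commutes, FiniteField.coe_frobeniusAlgHom] at this
      rw [pow_succ, pow_mul, ih, ← map_pow, hfrob, hθq, map_pow]
      ring
  have hnorm : ((algebraMap F K b - θ) ^ (N / r)) ^ r = algebraMap F K c := by
    rw [← pow_mul, Nat.div_mul_cancel hdvdN, hN, ← Finset.prod_pow_eq_pow_sum,
      Finset.prod_congr rfl fun i _ => hconj i, ← hprim.pow_sub_pow_eq_prod_range hrp.pos, hθ, ha]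
    simp
  refine ⟨hdvdN, FiniteField.mem_range_algebraMap_of_pow_card_eq ?_, hnorm⟩
  obtain ⟨x, rfl⟩ := hc
  have hx0 : x ≠ 0 := fun h => hc0 (by rw [h, zero_pow hr0])
  have hfixed : ((algebraMap F K b - θ) ^ (N / r)) ^ (q - 1) = 1 := by
    rw [← Nat.mul_div_cancel' hdvdq, pow_mul, hnorm, ← map_pow, ← pow_mul,
      Nat.mul_div_cancel' hdvdq, hq, FiniteField.pow_card_sub_one_eq_one x hx0, map_one]
  rw [← hq, ← hsucc, pow_succ, hfixed, one_mul]
end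

section
/- Let q be a prime power and r an odd prime with q ≡ 1 (mod r). Let c ≠ 0 be an r-th power residue in F_q, b ∈ F_q with b^r - c not an r-th power residue, θ ∈ F_{q^r} with θ^r = b^r - c, ω = θ^(q-1), and α = b - θ. Then each b - ω^i·θ is nonzero and, with exponents interpreted as integer powers in the unit group of F_{q^r}, α^((q-1)^(r-2)) = ∏_{i=0}^{r-2} (b - ω^i·θ)^((-1)^(r-i) · C(r-2, i)). -/
theorem zpow_finset_sum_of_ne_zero {G ι : Type*} [CommGroupWithZero G] {a : G} (ha : a ≠ 0)
    (s : Finset ι) (f : ι → ℤ) : a ^ (∑ i ∈ s, f i) = ∏ i ∈ s, a ^ f i := by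
  classical
  induction s using Finset.induction_on with
  | empty => simp
  | insert i s hi ih => rw [Finset.sum_insert hi, Finset.prod_insert hi, zpow_add₀ ha, ih]

/-- Binomial expansion of `a ^ ((q - 1) ^ n)` into powers of the iterates `a ^ (q ^ i)`. -/
theorem pow_sub_one_pow_eq_prod_zpow {G : Type*} [CommGroupWithZero G] {a : G} (ha : a ≠ 0)
    {q : ℕ} (hq : 1 ≤ q) (n : ℕ) :
    a ^ ((q - 1) ^ n) =
      ∏ i ∈ Finset.range (n + 1), (a ^ (q ^ i)) ^ ((-1) ^ (n - i) * (n.choose i) : ℤ) := by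
  have hexp : (((q - 1) ^ n : ℕ) : ℤ) =
      ∑ i ∈ Finset.range (n + 1), ((q ^ i : ℕ) : ℤ) * ((-1) ^ (n - i) * (n.choose i)) := by
    push_cast [hq]
    rw [sub_eq_add_neg, add_pow]
    exact Finset.sum_congr rfl fun i _ => by ring
  rw [← zpow_natCast, hexp, zpow_finset_sum_of_ne_zero ha]
  exact Finset.prod_congr rfl fun i _ => by rw [zpow_mul, zpow_natCast]

/-- The Williams–Hardy element `E₁ = α^((q-1)^(r-2))` equals the product
`∏_{i=0}^{r-2} (b - ω^i θ)^((-1)^(r-i)·C(r-2,i))`, each factor being nonzero. -/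
theorem williams_hardy_E1
    (F K : Type*) [Field F] [Field K] [Fintype F] [Fintype K] [Algebra F K]
    (q r : ℕ) (hq : q = Fintype.card F) (hK : Fintype.card K = q ^ r)
    (hrp : r.Prime) (hrodd : Odd r) (hqr : q ≡ 1 [MOD r])
    (c : F) (hc0 : c ≠ 0) (hc : ∃ x : F, x ^ r = c)
    (b : F) (hb : ¬ ∃ x : F, x ^ r = b ^ r - c)
    (θ : K) (hθ : θ ^ r = algebraMap F K (b ^ r - c))
    (ω : K) (hω : ω = θ ^ (q - 1)) :
    (∀ i ≤ r - 2, algebraMap F K b - ω ^ i * θ ≠ 0) ∧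
    (algebraMap F K b - θ) ^ ((q - 1) ^ (r - 2)) =
      ∏ i ∈ Finset.range (r - 1),
        (algebraMap F K b - ω ^ i * θ) ^ (((-1) ^ (r - i) * ((r - 2).choose i) : ℤ)) := by
  subst hq
  have hr0 : r ≠ 0 := hrp.ne_zero
  have hq1 : 1 ≤ Fintype.card F := Fintype.card_pos
  have hd : b ^ r - c ≠ 0 := fun h => hb ⟨0, by rw [h, zero_pow hr0]⟩
  have hωr : ω ^ r = 1 := by
    rw [hω, ← pow_mul, mul_comm, pow_mul, hθ, ← map_pow, FiniteField.pow_card_sub_one_eq_one _ hd,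
      map_one]
  have hωq : ω ^ Fintype.card F = ω := by
    obtain ⟨k, hk⟩ := (Nat.modEq_iff_dvd' hq1).1 hqr.symm
    rw [← Nat.sub_add_cancel hq1, hk, pow_succ, pow_mul, hωr, one_pow, one_mul]
  have hθq : θ ^ Fintype.card F = ω * θ := by
    rw [hω, ← pow_succ, Nat.sub_add_cancel hq1]
  have hne (i : ℕ) : algebraMap F K b - ω ^ i * θ ≠ 0 := fun h => by
    have hbr : algebraMap F K (b ^ r) = algebraMap F K (b ^ r - c) := by
      rw [map_pow, sub_eq_zero.1 h, mul_pow, hθ, ← pow_mul, mul_comm i, pow_mul, hωr, one_pow,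
        one_mul]
    exact hc0 (sub_eq_self.1 ((algebraMap F K).injective hbr).symm)
  have hfrob (i : ℕ) : (algebraMap F K b - ω ^ i * θ) ^ Fintype.card F =
      algebraMap F K b - ω ^ (i + 1) * θ := by
    have hpow (x : K) : FiniteField.frobeniusAlgHom F K x = x ^ Fintype.card F := rfl
    rw [← hpow, map_sub, AlgHom.commutes, map_mul, map_pow, hpow, hpow, hωq, hθq, pow_succ,
      mul_assoc]
  have hiter (i : ℕ) : (algebraMap F K b - θ) ^ (Fintype.card F ^ i) =
      algebraMap F K b - ω ^ i * θ := by
    induction i with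
    | zero => simp
    | succ i ih => rw [pow_succ, pow_mul, ih, hfrob]
  refine ⟨fun i _ => hne i, ?_⟩
  have hα : algebraMap F K b - θ ≠ 0 := by simpa using hne 0
  have hr2 : 2 ≤ r := hrp.two_le
  rw [pow_sub_one_pow_eq_prod_zpow hα hq1, show r - 2 + 1 = r - 1 by omega]
  refine Finset.prod_congr rfl fun i hi => ?_
  have hir : r - i = r - 2 - i + 2 := by
    have := Finset.mem_range.1 hi
    omega
  rw [hiter, hir, pow_add (-1 : ℤ), neg_one_sq, mul_one]
end

section
/- Let q be a prime power and r > 1 an integer with q ≡ 1 (mod r). Let θ be a nonzero element of F_{q^r} with θ^r ∈ (the image of) F_q, and let s be the multiplicative order of ω = θ^(q-1). Then s divides r, θ^(q^s) = θ, and θ^(q^t) ≠ θ for every t with 0 < t < s; consequently the degree of θ over F_q equals s. -/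
/-- If `θ ^ (q - 1)` is fixed by `x ↦ x ^ q`, then iterating `x ↦ x ^ q` on `θ` multiplies `θ` by
powers of `θ ^ (q - 1)`. -/
lemma pow_pow_eq_pow_mul_of_pow_eq_self {M : Type*} [CommMonoid M] {q : ℕ} (hq : 0 < q) {θ : M}
    (h : (θ ^ (q - 1)) ^ q = θ ^ (q - 1)) (t : ℕ) :
    θ ^ q ^ t = (θ ^ (q - 1)) ^ t * θ := by
  induction t with
  | zero => simp
  | succ t ih =>
    rw [pow_succ q, pow_mul, ih, mul_pow, pow_right_comm, h, pow_succ _ t, mul_assoc,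
      pow_sub_one_mul hq.ne']

/-- Over a finite field `F`, the degree of `θ` divides `n` iff `θ` is fixed by the `n`-th iterate of
the Frobenius of `F`. -/
lemma FiniteField.natDegree_minpoly_dvd_iff {F K : Type*} [Field F] [Finite F] [Field K]
    [Algebra F K] {θ : K} (hθ : IsIntegral F θ) {n : ℕ} :
    (minpoly F θ).natDegree ∣ n ↔ θ ^ Nat.card F ^ n = θ := by
  rw [(minpoly.irreducible hθ).natDegree_dvd_iff_dvd_X_pow_card_pow_sub_X, minpoly.dvd_iff]
  simp [sub_eq_zero]


/-- if `s` is the multiplicative order of `ω = θ^(q-1)` then `s ∣ r`,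
`θ^(q^s) = θ`, `θ^(q^t) ≠ θ` for `0 < t < s`, and the degree of `θ` over `F_q` is `s`. -/
theorem degree_eq_orderOf
    (F K : Type*) [Field F] [Field K] [Fintype F] [Fintype K] [Algebra F K]
    (q r : ℕ) (hq : q = Fintype.card F) (hK : Fintype.card K = q ^ r)
    (hr : 1 < r) (hqr : q ≡ 1 [MOD r])
    (θ : K) (hθ0 : θ ≠ 0) (hθ : θ ^ r ∈ Set.range (algebraMap F K))
    (s : ℕ) (hs : s = orderOf (θ ^ (q - 1))) :
    s ∣ r ∧ θ ^ (q ^ s) = θ ∧ (∀ t, 0 < t → t < s → θ ^ (q ^ t) ≠ θ) ∧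
      (minpoly F θ).natDegree = s := by
  have hq0 : 0 < q := hq ▸ Fintype.card_pos
  have hωr : (θ ^ (q - 1)) ^ r = 1 := by
    obtain ⟨a, ha⟩ := hθ
    have ha0 : a ≠ 0 := by
      rintro rfl
      exact pow_ne_zero r hθ0 (by rw [← ha, map_zero])
    rw [pow_right_comm, ← ha, ← map_pow, hq, FiniteField.pow_card_sub_one_eq_one a ha0, map_one]
  have hsr : s ∣ r := hs ▸ orderOf_dvd_of_pow_eq_one hωr
  have hωq : (θ ^ (q - 1)) ^ q = θ ^ (q - 1) := by
    rw [pow_eq_pow_mod q hωr, (hqr : q % r = 1 % r), Nat.mod_eq_of_lt hr, pow_one]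
  have hfix (t : ℕ) : θ ^ q ^ t = θ ↔ s ∣ t := by
    rw [pow_pow_eq_pow_mul_of_pow_eq_self hq0 hωq, mul_eq_right₀ hθ0, hs,
      orderOf_dvd_iff_pow_eq_one]
  have hdeg (n : ℕ) : (minpoly F θ).natDegree ∣ n ↔ s ∣ n := by
    rw [FiniteField.natDegree_minpoly_dvd_iff (Algebra.IsIntegral.isIntegral θ),
      Nat.card_eq_fintype_card, ← hq, hfix]
  exact ⟨hsr, (hfix s).mpr dvd_rfl,
    fun t ht hts h => Nat.not_dvd_of_pos_of_lt ht hts ((hfix t).mp h),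
    Nat.dvd_antisymm ((hdeg s).mpr dvd_rfl) ((hdeg _).mp dvd_rfl)⟩
end
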